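/- arXiv:2405.05902 — 2 statements merged into one kernel-verified Lean document; each statement's English description precedes it below -/
import Mathlib

section
/- Let Γ be a vertex-transitive graph on n vertices with clique number ω. Then Γ has an induced subgraph Γ' with at least e(Γ)/2 edges such that the complement of Γ' has chromatic number at most (ln 4)·n/ω. -/
open scoped Classical
open Finset SimpleGraph

theorem add_mul_sub_le_pow (s t : ℝ) (hs : 0 ≤ s) (ht : 0 ≤ t) (k : ℕ) :
    s ^ k + k * s ^ (k - 1) * (t - s) ≤ t ^ k := by
  induction k with
  | zero => simp
  | succ k ih =>
    rcases k with _ | k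
    · simp
    · have := mul_le_mul_of_nonneg_left ih ht
      simp only [Nat.add_sub_cancel, pow_succ] at this ⊢
      push_cast at this ⊢
      have h2 : 0 ≤ s ^ k * ((t - s)^2 * (k+1)) := by positivity
      nlinarith

theorem half_le_one_sub_one_sub_pow_sq (x : ℝ) (k : ℕ) (hk : 2 ≤ k) (hx1 : x ≤ 1) (hx : Real.log 4 < x * (k + 1)) :
    1 / 2 ≤ (1 - (1 - x) ^ k) ^ 2 := by
  have hL : Real.log 4 = 2 * Real.log 2 := by
    rw [show (4 : ℝ) = 2 ^ 2 by norm_num, Real.log_pow]; norm_num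
  have h1 := Real.log_two_gt_d9
  have h2 := Real.log_two_lt_d9
  set L := Real.log 4 with hLdef
  have hLl : 1.3862 < L := by linarith
  have hLu : L < 1.3863 := by linarith
  suffices h : (1 - x) ^ k ≤ 0.2928 by nlinarith
  obtain rfl | hk3 := hk.eq_or_lt
  · norm_num at hx
    have : 0.462 < x := by linarith
    nlinarith
  have hm : (4 : ℝ) ≤ k + 1 := by
    have : (3 : ℝ) ≤ k := by exact_mod_cast hk3
    linarith
  set y : ℝ := 1 / (k + 1) with hy
  have hy0 : 0 < y := by positivity
  have hy4 : y ≤ 1 / 4 := one_div_le_one_div_of_le (by norm_num) hm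
  have hky : k * y = 1 - y := by rw [hy]; field_simp; ring
  have hxy : L * y < x := by
    rw [hy, mul_one_div, div_lt_iff₀ (by positivity)]; exact hx
  set z := L * y with hz
  have hz0 : 0 < z := by positivity
  have hz1 : z < 1 := by nlinarith
  have hlog : z + z ^ 2 / 2 + z ^ 3 / 3 ≤ -Real.log (1 - z) := by
    have hs := Real.hasSum_pow_div_log_of_abs_lt_one (x := z) (by rwa [abs_of_pos hz0])
    have := sum_le_hasSum (Finset.range 3) (fun i _ => by positivity) hs
    norm_num [Finset.sum_range_succ] at this
    linarith
  have hpow : (1 - z) ^ k ≤ Real.exp (-(k * (z + z ^ 2 / 2 + z ^ 3 / 3))) := by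
    rw [show (1 - z) ^ k = Real.exp (k * Real.log (1 - z)) by
      rw [Real.exp_nat_mul, Real.exp_log (by linarith)]]
    apply Real.exp_le_exp.2
    have : (0 : ℝ) ≤ k := by positivity
    nlinarith
  have hkey : L - k * (z + z ^ 2 / 2 + z ^ 3 / 3) ≤ 0.14 := by
    have : k * (z + z ^ 2 / 2 + z ^ 3 / 3) = (1 - y) * (L + L ^ 2 * y / 2 + L ^ 3 * y ^ 2 / 3) := by
      rw [← hky, hz]; ring
    rw [this]
    have a1 : (1.9215 : ℝ) ≤ L ^ 2 := by nlinarith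
    have a2 : (2.66 : ℝ) ≤ L ^ 3 := by nlinarith
    calc _ ≤ 1.3863 - (1 - y) * (1.3862 + 1.9215 * y / 2 + 2.66 * y ^ 2 / 3) := by
          gcongr
          linarith
      _ ≤ _ := by nlinarith [mul_nonneg hy0.le (sub_nonneg.2 hy4), pow_pos hy0 2, mul_nonneg (pow_pos hy0 2).le (sub_nonneg.2 hy4)]
  calc (1 - x) ^ k ≤ (1 - z) ^ k := by gcongr
    _ ≤ _ := hpow
    _ ≤ Real.exp (0.14 - L) := Real.exp_le_exp.2 (by linarith)
    _ = Real.exp 0.14 / 4 := by rw [Real.exp_sub, hLdef, Real.exp_log (by norm_num)]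
    _ ≤ 0.2928 := by
      have h3 := Real.add_one_le_exp (-0.14 : ℝ)
      have h4 : Real.exp (-0.14) * Real.exp 0.14 = 1 := by rw [← Real.exp_add]; norm_num
      nlinarith [Real.exp_pos 0.14]

theorem exists_tuple_covering_pairs {V I : Type*} [Fintype I] [Nonempty I] (F : I → Finset V) (D : Finset (V × V))
    (x : ℝ)
    (hF : ∀ v, (#{i | v ∈ F i} : ℝ) = x * Fintype.card I)
    (hD : x ^ 2 * Fintype.card I * #D ≤ ∑ i, (#{p ∈ D | p.1 ∈ F i ∧ p.2 ∈ F i} : ℝ)) (k : ℕ) :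
    ∃ T : Fin k → I, (1 - (1 - x) ^ k) ^ 2 * #D ≤
      (#{p ∈ D | (∃ j, p.1 ∈ F (T j)) ∧ ∃ j, p.2 ∈ F (T j)} : ℝ) := by
  set N : ℝ := (Fintype.card I : ℝ) with hN
  have hN0 : 0 < N := by rw [hN]; exact_mod_cast Fintype.card_pos
  have hcount (B : Finset I) : (#{T : Fin k → I | ∀ j, T j ∈ B} : ℝ) = (#B : ℝ) ^ k := by
    have := Fintype.card_piFinset_const B k
    rw [← Nat.cast_pow, ← this]
    congr 2
    ext T; simp
  have h1 (u : V) : (#{T : Fin k → I | ∀ j, u ∉ F (T j)} : ℝ) = (N - x * N) ^ k := by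
    have := hcount {i | u ∉ F i}
    simp only [mem_filter, mem_univ, true_and] at this
    rw [this, ← hF u, hN]
    have := card_filter_add_card_filter_not (s := (univ : Finset I)) (fun i => u ∈ F i)
    rw [card_univ] at this
    rw [← this]; push_cast; ring
  set b : V × V → ℝ := fun p => #{i | p.1 ∈ F i ∧ p.2 ∈ F i} with hb
  have hcard (p : V × V) : (#{i | p.1 ∉ F i ∧ p.2 ∉ F i} : ℝ) = N - 2 * (x * N) + b p := by
    rw [two_mul]
    nth_rewrite 1 [← hF p.1]
    rw [← hF p.2, hb, hN, ← card_univ, card_eq_sum_ones univ]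
    simp only [card_filter]
    push_cast
    rw [← sub_sub, ← sum_sub_distrib, ← sum_sub_distrib, ← sum_add_distrib]
    refine sum_congr rfl fun i _ => ?_
    by_cases ha : p.1 ∈ F i <;> by_cases hc : p.2 ∈ F i <;> simp [ha, hc]
  have h2 (p : V × V) : (#{T : Fin k → I | (∀ j, p.1 ∉ F (T j)) ∧ ∀ j, p.2 ∉ F (T j)} : ℝ) =
      (N - 2 * (x * N) + b p) ^ k := by
    have := hcount {i | p.1 ∉ F i ∧ p.2 ∉ F i}
    simp only [mem_filter, mem_univ, true_and, forall_and] at this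
    rw [this, hcard]
  have h3 (p : V × V) : (#{T : Fin k → I | (∃ j, p.1 ∈ F (T j)) ∧ ∃ j, p.2 ∈ F (T j)} : ℝ) =
      N ^ k - 2 * (N - x * N) ^ k + (N - 2 * (x * N) + b p) ^ k := by
    rw [← h2, two_mul]
    nth_rewrite 1 [← h1 p.1]
    have hNk : N ^ k = ((univ : Finset (Fin k → I)).card : ℝ) := by simp [hN]
    rw [← h1 p.2, hNk, card_eq_sum_ones univ]
    simp only [card_filter]
    push_cast
    rw [← sub_sub, ← sum_sub_distrib, ← sum_sub_distrib, ← sum_add_distrib]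
    refine sum_congr rfl fun T _ => ?_
    by_cases ha : ∃ j, p.1 ∈ F (T j) <;> by_cases hc : ∃ j, p.2 ∈ F (T j) <;>
      simp only [← not_exists, ha, hc] <;> norm_num
  have hbsum : x ^ 2 * N * #D ≤ ∑ p ∈ D, b p := by
    refine hD.trans_eq ?_
    simp only [hb, card_filter]
    push_cast
    exact sum_comm
  set s := N * (1 - x) ^ 2 with hs
  have hs0 : 0 ≤ s := by positivity
  have h4 : s ^ k * #D ≤ ∑ p ∈ D, (N - 2 * (x * N) + b p) ^ k := by
    calc s ^ k * #D ≤ ∑ p ∈ D, (s ^ k + k * s ^ (k - 1) * (N - 2 * (x * N) + b p - s)) := by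
          rw [sum_add_distrib, ← mul_sum, sum_const, nsmul_eq_mul, mul_comm]
          have : 0 ≤ ∑ p ∈ D, (N - 2 * (x * N) + b p - s) := by
            simp only [sum_sub_distrib, sum_add_distrib, sum_const, nsmul_eq_mul, hs]
            nlinarith
          have : 0 ≤ k * s ^ (k - 1) * ∑ p ∈ D, (N - 2 * (x * N) + b p - s) := by positivity
          linarith
      _ ≤ _ := sum_le_sum fun p _ => add_mul_sub_le_pow _ _ hs0 (by rw [← hcard]; positivity) k
  have h5 : N ^ k * ((1 - (1 - x) ^ k) ^ 2 * #D) ≤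
      ∑ T : Fin k → I, (#{p ∈ D | (∃ j, p.1 ∈ F (T j)) ∧ ∃ j, p.2 ∈ F (T j)} : ℝ) := by
    calc _ = (N ^ k - 2 * (N - x * N) ^ k) * #D + s ^ k * #D := by
          rw [show N - x * N = N * (1 - x) by ring, hs, mul_pow, mul_pow, ← pow_mul, mul_comm 2 k,
            pow_mul]
          ring
      _ ≤ ∑ p ∈ D, (N ^ k - 2 * (N - x * N) ^ k + (N - 2 * (x * N) + b p) ^ k) := by
          rw [sum_add_distrib, sum_const, nsmul_eq_mul, mul_comm (#D : ℝ)]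
          linarith
      _ = ∑ p ∈ D, (#{T : Fin k → I | (∃ j, p.1 ∈ F (T j)) ∧ ∃ j, p.2 ∈ F (T j)} : ℝ) :=
          sum_congr rfl fun p _ => (h3 p).symm
      _ = _ := by
          simp only [card_filter]
          push_cast
          exact sum_comm
  by_contra! hcon
  have := sum_lt_sum_of_nonempty (univ_nonempty (α := Fin k → I)) fun T _ => hcon T
  rw [sum_const, nsmul_eq_mul, card_univ, Fintype.card_pi_const] at this
  push_cast at this
  linarith

theorem two_mul_card_edgeFinset_eq {V : Type*} [Fintype V] (H : SimpleGraph V)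
    [Fintype H.edgeSet] : 2 * #H.edgeFinset = #{p : V × V | H.Adj p.1 p.2} := by
  convert H.two_mul_card_edgeFinset

theorem two_mul_card_edgeFinset_induce {V : Type*} [Fintype V] (Γ : SimpleGraph V) (S : Finset V)
    [Fintype (Γ.induce (S : Set V)).edgeSet] :
    2 * #(Γ.induce (S : Set V)).edgeFinset =
      #{p ∈ ({p : V × V | Γ.Adj p.1 p.2} : Finset (V × V)) | p.1 ∈ S ∧ p.2 ∈ S} := by
  rw [two_mul_card_edgeFinset_eq]
  refine card_bij (fun p _ => (p.1.1, p.2.1)) ?_ ?_ ?_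
  · rintro ⟨⟨a, ha⟩, b, hb⟩ h
    simpa using ⟨by simpa using h, ha, hb⟩
  · rintro ⟨⟨a, ha⟩, b, hb⟩ - ⟨⟨c, hc⟩, d, hd⟩ - h
    simpa using h
  · rintro ⟨a, b⟩ h
    simp only [mem_filter, mem_univ, true_and] at h
    exact ⟨(⟨a, h.2.1⟩, ⟨b, h.2.2⟩), by simpa using h.1, rfl⟩

/-- A union of `k` cliques induces a subgraph whose complement is `k`-colorable. -/
theorem colorable_compl_induce_of_cliques {V : Type*} (Γ : SimpleGraph V) {k : ℕ}
    (C : Fin k → Finset V) (hC : ∀ j, Γ.IsClique (C j : Set V)) (S : Set V)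
    (hS : ∀ v ∈ S, ∃ j, v ∈ C j) : (Γ.induce S)ᶜ.Colorable k := by
  choose f hf using hS
  refine ⟨Coloring.mk (fun v => f v.1 v.2) ?_⟩
  rintro ⟨u, hu⟩ ⟨v, hv⟩ huv h
  rw [compl_adj] at huv
  refine huv.2 (hC (f u hu) (hf u hu) ?_ fun e => huv.1 (Subtype.ext e))
  have h : f u hu = f v hv := h
  rw [h]
  exact hf v hv

/-- In a regular graph, a maximum clique `A` satisfies `#A * d ≤ n * (#A - 1)`. -/
theorem card_mul_degree_add_card_le {V : Type*} [Fintype V] (Γ : SimpleGraph V) {A : Finset V}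
    {d : ℕ} (hd : ∀ v, Γ.degree v = d) (hA : Γ.IsClique (A : Set V))
    (hmax : ∀ B : Finset V, Γ.IsClique (B : Set V) → #B ≤ #A) :
    #A * d + Fintype.card V ≤ Fintype.card V * #A := by
  have key (v : V) : #{a ∈ A | Γ.Adj v a} + 1 ≤ #A := by
    refine Nat.succ_le_of_lt (card_lt_card (filter_ssubset.2 ?_))
    by_contra! h
    have hv : v ∉ A := fun hv => Γ.loopless.irrefl v (h v hv)
    have := hmax (insert v A) (by
      rw [coe_insert]
      exact hA.insert fun b hb _ => h b hb)
    rw [card_insert_of_notMem hv] at this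
    omega
  have h1 := sum_le_sum fun v (_ : v ∈ (univ : Finset V)) => key v
  have h2 : ∑ v, #{a ∈ A | Γ.Adj v a} = #A * d := by
    simp only [card_filter]
    rw [sum_comm, sum_const_nat]
    intro a _
    rw [← hd a, ← card_neighborFinset_eq_degree, neighborFinset_eq_filter, card_filter]
    simp only [Γ.adj_comm a]
  rw [sum_add_distrib, h2] at h1
  simpa using h1

theorem stmt_1 {V : Type*} [Fintype V] [Nonempty V] (Γ : SimpleGraph V) (ω : ℕ)
    (htrans : ∀ u v : V, ∃ g : Γ ≃g Γ, g u = v)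
    (hω₁ : ∃ A : Finset V, Γ.IsNClique ω A)
    (hω₂ : ∀ (n : ℕ) (A : Finset V), Γ.IsNClique n A → n ≤ ω) :
    ∃ S : Finset V,
      (Γ.edgeFinset.card : ℝ) / 2 ≤ ((Γ.induce (S : Set V)).edgeFinset.card : ℝ) ∧
      ((Γ.induce (S : Set V))ᶜ.chromaticNumber : ℕ∞) ≤
        (⌊Real.log 4 * (Fintype.card V : ℝ) / (ω : ℝ)⌋₊ : ℕ∞) := by
  obtain ⟨A, hA, rfl⟩ := hω₁
  have hmax (B : Finset V) (hB : Γ.IsClique (B : Set V)) : #B ≤ #A := hω₂ _ B ⟨hB, rfl⟩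
  obtain ⟨v₀⟩ := ‹Nonempty V›
  have hω0 : 0 < #A := by simpa using hmax {v₀} (by simp)
  set n := Fintype.card V with hn
  have hωn : #A ≤ n := card_le_univ A
  have hn0 : 0 < n := hω0.trans_le hωn
  have hωR : (0 : ℝ) < #A := by exact_mod_cast hω0
  have hnR : (0 : ℝ) < n := by exact_mod_cast hn0
  have hlog : 1.38 < Real.log 4 := by
    have := Real.log_two_gt_d9
    rw [show (4 : ℝ) = 2 ^ 2 by norm_num, Real.log_pow]
    push_cast
    linarith
  set k := ⌊Real.log 4 * (n : ℝ) / (#A : ℝ)⌋₊ with hk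
  set D : Finset (V × V) := {p : V × V | Γ.Adj p.1 p.2} with hD
  by_cases hcomplete : ∀ u v, u ≠ v → Γ.Adj u v
  · have hk1 : 1 ≤ k := by
      rw [hk, Nat.one_le_floor_iff, le_div_iff₀ hωR]
      have : (#A : ℝ) ≤ n := by exact_mod_cast hωn
      nlinarith
    refine ⟨univ, ?_, Colorable.chromaticNumber_le ((colorable_compl_induce_of_cliques Γ
      (fun _ : Fin 1 => univ) (fun _ u _ v _ => hcomplete u v) _ fun v _ => ⟨0, mem_univ v⟩).mono
        hk1)⟩
    have h1 := two_mul_card_edgeFinset_eq Γ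
    have h2 := two_mul_card_edgeFinset_induce Γ univ
    simp only [mem_univ, true_and, filter_true] at h2
    rw [← h1] at h2
    have h3 : #Γ.edgeFinset ≤ #(Γ.induce ((univ : Finset V) : Set V)).edgeFinset := by omega
    have h3' : (#Γ.edgeFinset : ℝ) ≤ #(Γ.induce ((univ : Finset V) : Set V)).edgeFinset := by
      exact_mod_cast h3
    have : (0 : ℝ) ≤ #Γ.edgeFinset := by positivity
    linarith
  have hfin : Finite (Γ ≃g Γ) := DFunLike.finite _
  let _ : Fintype (Γ ≃g Γ) := Fintype.ofFinite _
  have _ : Nonempty (Γ ≃g Γ) := ⟨RelIso.refl _⟩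
  set N : ℝ := (Fintype.card (Γ ≃g Γ) : ℝ) with hN
  have hN0 : 0 < N := by rw [hN]; exact_mod_cast Fintype.card_pos
  let F : (Γ ≃g Γ) → Finset V := fun g => A.image g
  have hFcard (g) : #(F g) = #A := card_image_of_injective _ g.injective
  have hFclique (g) : Γ.IsClique (F g : Set V) := by
    intro u hu v hv huv
    obtain ⟨a, ha, rfl⟩ := mem_image.1 (mem_coe.1 hu)
    obtain ⟨b, hb, rfl⟩ := mem_image.1 (mem_coe.1 hv)
    exact g.map_adj_iff.2 (hA ha hb fun h => huv (h ▸ rfl))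
  have hle (u v : V) : #{g | u ∈ F g} ≤ #{g | v ∈ F g} := by
    obtain ⟨h, rfl⟩ := htrans u v
    refine card_le_card_of_injOn (fun g => g.trans h) ?_ ?_
    · intro g hg
      simp only [coe_filter, mem_univ, true_and, Set.mem_ofPred_eq, F, mem_image] at hg ⊢
      obtain ⟨a, ha, rfl⟩ := hg
      exact ⟨a, ha, rfl⟩
    · intro g _ g' _ hgg
      ext a
      exact h.injective (DFunLike.congr_fun hgg a)
  have hF (v : V) : (#{g | v ∈ F g} : ℝ) = #A / n * N := by
    have h1 : ∑ u, #{g | u ∈ F g} = n * #{g | v ∈ F g} := by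
      rw [sum_const_nat fun u _ => (hle u v).antisymm (hle v u), card_univ]
    have h2 : ∑ u, #{g | u ∈ F g} = Fintype.card (Γ ≃g Γ) * #A := by
      simp only [card_filter]
      rw [sum_comm, sum_const_nat (m := #A), card_univ]
      intro g _
      rw [← card_filter, filter_univ_mem, hFcard]
    have h3 : (n : ℝ) * #{g | v ∈ F g} = N * #A := by rw [hN]; exact_mod_cast h1.symm.trans h2
    field_simp
    linarith
  have hhalf : (#A : ℝ) / n ≤ 1 / 2 := by
    push Not at hcomplete
    obtain ⟨u, v, huv, hadj⟩ := hcomplete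
    have hdisj : Disjoint ({g | u ∈ F g} : Finset (Γ ≃g Γ)) ({g | v ∈ F g} : Finset (Γ ≃g Γ)) :=
      disjoint_filter.2 fun g _ hu hv => hadj (hFclique g hu hv huv)
    have h := card_le_univ (({g | u ∈ F g} : Finset (Γ ≃g Γ)) ∪ ({g | v ∈ F g} : Finset (Γ ≃g Γ)))
    rw [card_union_of_disjoint hdisj] at h
    have h' : (#{g | u ∈ F g} : ℝ) + #{g | v ∈ F g} ≤ N := by rw [hN]; exact_mod_cast h
    rw [hF, hF] at h'
    nlinarith
  have hreg (v : V) : Γ.degree v = Γ.degree v₀ := by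
    obtain ⟨g, rfl⟩ := htrans v₀ v
    exact g.degree_eq v₀
  have hDcard : #D = n * Γ.degree v₀ := by
    rw [hD, ← two_mul_card_edgeFinset_eq, ← Γ.sum_degrees_eq_twice_card_edges,
      sum_const_nat fun v _ => hreg v, card_univ]
  have hpairs : ((#A : ℝ) / n) ^ 2 * N * #D ≤ ∑ g, (#{p ∈ D | p.1 ∈ F g ∧ p.2 ∈ F g} : ℝ) := by
    have h1 (g) : (#A : ℝ) * #A - #A ≤ #{p ∈ D | p.1 ∈ F g ∧ p.2 ∈ F g} := by
      have : (F g).offDiag ⊆ {p ∈ D | p.1 ∈ F g ∧ p.2 ∈ F g} := by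
        intro p hp
        rw [mem_offDiag] at hp
        simp only [hD, mem_filter, mem_univ, true_and]
        exact ⟨hFclique g hp.1 hp.2.1 hp.2.2, hp.1, hp.2.1⟩
      have := card_le_card this
      rw [offDiag_card, hFcard, tsub_le_iff_right] at this
      rw [sub_le_iff_le_add]
      exact_mod_cast this
    have h2 : (#A : ℝ) * Γ.degree v₀ + n ≤ n * #A := by
      exact_mod_cast card_mul_degree_add_card_le Γ hreg hA hmax
    calc _ = N * (#A * (#A * Γ.degree v₀ / n)) := by rw [hDcard]; push_cast; field_simp
      _ ≤ N * (#A * (#A - 1)) := by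
        gcongr
        rw [div_le_iff₀ hnR]
        linarith
      _ = ∑ _g : Γ ≃g Γ, ((#A : ℝ) * #A - #A) := by
        rw [sum_const, nsmul_eq_mul, card_univ]; ring
      _ ≤ _ := sum_le_sum fun g _ => h1 g
  have hk2 : 2 ≤ k := by
    rw [hk, Nat.le_floor_iff (by positivity), le_div_iff₀ hωR]
    rw [div_le_iff₀ hnR] at hhalf
    push_cast
    nlinarith
  have hxk : Real.log 4 < #A / n * (k + 1) := by
    have := Nat.lt_floor_add_one (Real.log 4 * (n : ℝ) / (#A : ℝ))
    rw [← hk, div_lt_iff₀ hωR] at this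
    rw [div_mul_eq_mul_div, lt_div_iff₀ hnR]
    linarith
  obtain ⟨T, hT⟩ := exists_tuple_covering_pairs F D (#A / n) hF hpairs k
  have hprob := half_le_one_sub_one_sub_pow_sq (#A / n) k hk2 (by linarith) hxk
  refine ⟨({v | ∃ j, v ∈ F (T j)} : Finset V), ?_, Colorable.chromaticNumber_le
    (colorable_compl_induce_of_cliques Γ (fun j => F (T j)) (fun j => hFclique _) _
      fun v hv => by simpa using hv)⟩
  have h1 := two_mul_card_edgeFinset_eq Γ
  have h2 := two_mul_card_edgeFinset_induce Γ ({v | ∃ j, v ∈ F (T j)} : Finset V)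
  simp only [mem_filter, mem_univ, true_and] at h2
  rw [← h2, ← h1] at hT
  push_cast at hT
  have : (0 : ℝ) ≤ #Γ.edgeFinset := by positivity
  nlinarith
end

section
/- Let F be a bipartite graph with parts of sizes r ≤ s and m ≥ 1 edges. If a graph Γ is not (1/(2m), r+s)-sparse, then Γ contains F as a subgraph. Equivalently, every F-free graph is (1/(2m), r+s)-sparse. -/
open scoped Classical
open Finset SimpleGraph

/-- A graph is `(c,t)`-sparse if any two vertex subsets of size at least `t` have
edge density (counting ordered pairs) at most `1 - c`. -/
def Sparse {V : Type*} [Fintype V] (Γ : SimpleGraph V) (c : ℝ) (t : ℕ) : Prop :=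
  ∀ A B : Finset V, t ≤ A.card → t ≤ B.card →
    (((A ×ˢ B).filter fun p => Γ.Adj p.1 p.2).card : ℝ) ≤ (1 - c) * A.card * B.card

/-- Averaging over cyclic shifts: an injection into `A` whose total cost is at most average. -/
theorem exists_embedding_mul_sum_le {V ι : Type*} [Fintype ι] (A : Finset V)
    (hA : Fintype.card ι ≤ A.card) (h : ι → V → ℕ) :
    ∃ f : ι ↪ V, (∀ i, f i ∈ A) ∧ A.card * ∑ i, h i (f i) ≤ ∑ i, ∑ x ∈ A, h i x := by
  rcases Nat.eq_zero_or_pos A.card with h0 | hpos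
  · have : IsEmpty ι := Fintype.card_eq_zero_iff.mp (by omega)
    exact ⟨Function.Embedding.ofIsEmpty, fun i => isEmptyElim i, by simp⟩
  have : NeZero A.card := ⟨hpos.ne'⟩
  let e : ZMod A.card ≃ A := Fintype.equivOfCardEq (by simp [ZMod.card])
  obtain ⟨j⟩ : Nonempty (ι ↪ ZMod A.card) :=
    Function.Embedding.nonempty_of_card_le (by simpa [ZMod.card] using hA)
  have hsum : ∑ k : ZMod A.card, ∑ i, h i (e (j i + k)) = ∑ i, ∑ x ∈ A, h i x := by
    rw [Finset.sum_comm]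
    refine Finset.sum_congr rfl fun i _ => ?_
    rw [← Finset.sum_coe_sort A (h i)]
    exact ((Equiv.addLeft (j i)).trans e).sum_comp fun x : A => h i x
  obtain ⟨k, -, hk⟩ := Finset.exists_min_image (Finset.univ : Finset (ZMod A.card))
    (fun k => ∑ i, h i (e (j i + k))) Finset.univ_nonempty
  refine ⟨⟨fun i => e (j i + k), fun a b hab => ?_⟩, fun i => (e (j i + k)).2, ?_⟩
  · exact j.injective (add_right_cancel (e.injective (Subtype.ext hab)))
  · rw [← hsum]
    have := Finset.card_nsmul_le_sum Finset.univ _ _ hk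
    rw [Finset.card_univ, ZMod.card, smul_eq_mul] at this
    exact this

/-- The pairs of adjacent vertices across a sum type are no more numerous than the edges. -/
theorem card_filter_adj_inl_inr_le {α β : Type*} [Fintype α] [Fintype β]
    (F : SimpleGraph (α ⊕ β)) :
    (Finset.univ.filter fun p : α × β => F.Adj (Sum.inl p.1) (Sum.inr p.2)).card
      ≤ F.edgeFinset.card := by
  refine Finset.card_le_card_of_injOn (fun p => s(Sum.inl p.1, Sum.inr p.2)) ?_ ?_
  · intro p hp
    simpa using hp
  · rintro ⟨a, b⟩ - ⟨c, d⟩ - hp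
    simpa using hp

/-- A dense pair of vertex sets has few non-adjacent pairs. -/
theorem exists_card_not_adj_lt_of_not_sparse {V : Type*} [Fintype V] {Γ : SimpleGraph V}
    {m t : ℕ} (hm : 1 ≤ m) (h : ¬ Sparse Γ (1 / (2 * m)) t) :
    ∃ A B : Finset V, t ≤ A.card ∧ t ≤ B.card ∧
      2 * m * (∑ x ∈ A, (B.filter fun y => ¬ Γ.Adj x y).card) < A.card * B.card := by
  simp only [Sparse, not_forall, not_le] at h
  obtain ⟨A, B, hA, hB, hlt⟩ := h
  refine ⟨A, B, hA, hB, ?_⟩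
  have hsplit := Finset.card_filter_add_card_filter_not (s := A ×ˢ B) fun p => Γ.Adj p.1 p.2
  have hbad : ((A ×ˢ B).filter fun p => ¬ Γ.Adj p.1 p.2).card
      = ∑ x ∈ A, (B.filter fun y => ¬ Γ.Adj x y).card := by
    simp only [Finset.card_filter, Finset.sum_product]
  rw [hbad, Finset.card_product] at hsplit
  have hm' : (0 : ℝ) < m := by exact_mod_cast hm
  have hsplit' := congrArg (Nat.cast : ℕ → ℝ) hsplit
  push_cast at hsplit'
  have hlt' : (2 * m : ℝ) * ((1 - 1 / (2 * m)) * A.card * B.card) <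
      2 * m * ((A ×ˢ B).filter fun p => Γ.Adj p.1 p.2).card := by gcongr
  have hexp : (2 * m : ℝ) * ((1 - 1 / (2 * m)) * A.card * B.card)
      = 2 * m * (A.card * B.card) - A.card * B.card := by
    field_simp
  have key : (2 * m : ℝ) * ((∑ x ∈ A, (B.filter fun y => ¬ Γ.Adj x y).card : ℕ) : ℝ)
      < A.card * B.card := by
    push_cast
    rw [hexp, ← hsplit'] at hlt'
    rw [← hsplit']
    linarith
  exact_mod_cast key

theorem stmt_9 {V : Type*} [Fintype V] (Γ : SimpleGraph V) (r s m : ℕ)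
    (hrs : r ≤ s) (hm : 1 ≤ m)
    (F : SimpleGraph (Fin r ⊕ Fin s))
    (hFbip : (∀ a b : Fin r, ¬ F.Adj (Sum.inl a) (Sum.inl b)) ∧
             (∀ a b : Fin s, ¬ F.Adj (Sum.inr a) (Sum.inr b)))
    (hFm : F.edgeFinset.card = m)
    (hnotsparse : ¬ Sparse Γ (1 / (2 * m)) (r + s)) :
    ∃ f : F →g Γ, Function.Injective f := by
  obtain ⟨A, B, hA, hB, hAB⟩ := exists_card_not_adj_lt_of_not_sparse hm hnotsparse
  set N : V → ℕ := fun x => (B.filter fun y => ¬ Γ.Adj x y).card with hN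
  obtain ⟨f, hfA, hf⟩ := exists_embedding_mul_sum_le (ι := Fin r) A (by simp; omega)
    fun a x => ∑ b : Fin s, if F.Adj (Sum.inl a) (Sum.inr b) then N x else 0
  set B' := B \ Finset.univ.map f with hB'
  have hcard : B.card ≤ B'.card + r := by
    have := Finset.le_card_sdiff (Finset.univ.map f) B
    rw [← hB', Finset.card_map, Finset.card_univ, Fintype.card_fin] at this
    omega
  obtain ⟨g, hgB, hg⟩ := exists_embedding_mul_sum_le (ι := Fin s) B' (by simp; omega)
    fun b y => ∑ a : Fin r,
      if F.Adj (Sum.inl a) (Sum.inr b) ∧ ¬ Γ.Adj (f a) y then 1 else 0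
  have hedges : ∑ a : Fin r, ∑ b : Fin s,
      (if F.Adj (Sum.inl a) (Sum.inr b) then 1 else 0) ≤ m := by
    have := card_filter_adj_inl_inr_le F
    rw [Finset.card_filter, Fintype.sum_prod_type] at this
    exact this.trans_eq hFm
  have hf' : ∑ a : Fin r, ∑ x ∈ A, ∑ b : Fin s,
      (if F.Adj (Sum.inl a) (Sum.inr b) then N x else 0) ≤ m * ∑ x ∈ A, N x := by
    refine le_trans (le_of_eq ?_) (Nat.mul_le_mul_right _ hedges)
    rw [Finset.sum_mul]
    refine Finset.sum_congr rfl fun a _ => ?_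
    rw [Finset.sum_comm, Finset.sum_mul]
    refine Finset.sum_congr rfl fun b _ => ?_
    split_ifs <;> simp
  have hg' : ∑ b : Fin s, ∑ y ∈ B', ∑ a : Fin r,
      (if F.Adj (Sum.inl a) (Sum.inr b) ∧ ¬ Γ.Adj (f a) y then 1 else 0)
      ≤ ∑ a : Fin r, ∑ b : Fin s, if F.Adj (Sum.inl a) (Sum.inr b) then N (f a) else 0 := by
    rw [Finset.sum_comm (s := (Finset.univ : Finset (Fin r)))]
    refine Finset.sum_le_sum fun b _ => ?_
    rw [Finset.sum_comm]
    refine Finset.sum_le_sum fun a _ => ?_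
    by_cases hab : F.Adj (Sum.inl a) (Sum.inr b)
    · simp only [hab, true_and, if_true, hN, ← Finset.card_filter]
      exact Finset.card_le_card (Finset.filter_subset_filter _ Finset.sdiff_subset)
    · simp [hab]
  have hbad : ∑ b : Fin s, ∑ a : Fin r,
      (if F.Adj (Sum.inl a) (Sum.inr b) ∧ ¬ Γ.Adj (f a) (g b) then 1 else 0) = 0 := by
    set S := ∑ b : Fin s, ∑ a : Fin r,
      (if F.Adj (Sum.inl a) (Sum.inr b) ∧ ¬ Γ.Adj (f a) (g b) then 1 else 0)
    by_contra hS
    have h1 : B.card ≤ 2 * (B'.card * S) := by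
      have := Nat.le_mul_of_pos_right B'.card (Nat.pos_of_ne_zero hS)
      omega
    have h2 : A.card * B.card ≤ A.card * (2 * (B'.card * S)) := Nat.mul_le_mul_left _ h1
    have h3 := Nat.mul_le_mul_left A.card (hg.trans hg')
    have h4 := hf.trans hf'
    linarith
  have hadj : ∀ a b, F.Adj (Sum.inl a) (Sum.inr b) → Γ.Adj (f a) (g b) := by
    intro a b hab
    by_contra hΓ
    simp only [Finset.sum_eq_zero_iff, Finset.mem_univ, true_implies] at hbad
    simpa [hab, hΓ] using hbad b a
  refine ⟨⟨Sum.elim f g, ?_⟩, ?_⟩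
  · rintro (a | b) (c | d) h
    · exact (hFbip.1 a c h).elim
    · exact hadj a d h
    · exact (hadj c b h.symm).symm
    · exact (hFbip.2 b d h).elim
  · refine Function.Injective.sumElim f.injective g.injective fun a b hab => ?_
    have := hgB b
    simp [hB', ← hab] at this
end
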